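/- arXiv:0705.3588 — 2 statements merged into one kernel-verified Lean document; each statement's English description precedes it below -/
import Mathlib

section
/- Let f : (0,∞) → [0,∞) be a measurable, locally bounded function, let γ ∈ ℝ, and let K be slowly varying at infinity. Assume that f(x) ~ x^γ K(x) as x → ∞ and that limsup_{x→0+} f(x) x^{−γ} < ∞. Then for any γ′ and γ″ with γ′ < γ < γ″, there exist constants C > 0 and λ₀ > 0 such that f(λx)/(λ^γ K(λ)) ≤ C · max{x^{γ′}, x^{γ″}} for all x > 0 and all λ > λ₀. (Lemma 6.6) -/
open Filter Topology Set

open MeasureTheory in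
/-- If the increments of a measurable function tend to zero at infinity, those over bounded shifts
are eventually uniformly bounded. -/
lemma exists_forall_abs_increment_le_two {h : ℝ → ℝ} (hm : Measurable h)
    (hlim : ∀ u, Tendsto (fun t => h (t + u) - h t) atTop (𝓝 0)) :
    ∃ T, ∀ t ≥ T, ∀ u ∈ Icc (0 : ℝ) 1, |h (t + u) - h t| ≤ 2 := by
  let S : ℝ → Set ℝ := fun t => Icc 0 2 ∩ {u | |h (t + u) - h t| ≤ 1}
  have hSm (t : ℝ) : MeasurableSet (S t) :=
    measurableSet_Icc.inter (measurableSet_le (by fun_prop) measurable_const)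
  have hvol : Tendsto (fun t => volume (S t)) atTop (𝓝 (volume (Icc (0 : ℝ) 2))) := by
    refine tendsto_measure_of_ae_tendsto_indicator atTop measurableSet_Icc hSm
      measurableSet_Icc (by simp) (Eventually.of_forall fun t => inter_subset_left) ?_
    refine Eventually.of_forall fun u => ?_
    have h1 : ∀ᶠ t in atTop, |h (t + u) - h t| < 1 := by
      simpa using (hlim u).abs.eventually (gt_mem_nhds (by simp))
    filter_upwards [h1] with t ht
    simp [S, ht.le]
  have hlt : ENNReal.ofReal (3 / 2) < volume (Icc (0 : ℝ) 2) := by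
    rw [Real.volume_Icc, ENNReal.ofReal_lt_ofReal_iff] <;> norm_num
  obtain ⟨T, hT⟩ := eventually_atTop.1 (hvol.eventually (lt_mem_nhds hlt))
  refine ⟨T, fun t ht u hu => ?_⟩
  have hmeet : (S t ∩ (fun v => -u + v) ⁻¹' S (t + u)).Nonempty := by
    refine nonempty_inter_of_measure_lt_add volume
      (u := Icc (0 : ℝ) 3) ((hSm _).preimage (by fun_prop)) ?_ ?_ ?_
    · exact inter_subset_left.trans (Icc_subset_Icc le_rfl (by norm_num))
    · rintro v ⟨⟨hv1, hv2⟩, -⟩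
      exact ⟨by linarith [hu.1], by linarith [hu.2]⟩
    · rw [measure_preimage_add]
      calc volume (Icc (0 : ℝ) 3) = ENNReal.ofReal (3 / 2) + ENNReal.ofReal (3 / 2) := by
            rw [← ENNReal.ofReal_add (by norm_num) (by norm_num), Real.volume_Icc]
            norm_num
        _ < _ := ENNReal.add_lt_add (hT t ht) (hT (t + u) (by linarith [hu.1]))
  obtain ⟨v, ⟨-, hv⟩, -, hw⟩ := hmeet
  simp only [mem_ofPred_eq] at hv hw
  rw [show t + u + (-u + v) = t + v by ring] at hw
  rw [abs_le] at *
  constructor <;> linarith [hv.1, hv.2, hw.1, hw.2]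

lemma exists_forall_abs_increment_le {h : ℝ → ℝ} (hm : Measurable h)
    (hlim : ∀ u, Tendsto (fun t => h (t + u) - h t) atTop (𝓝 0)) {δ : ℝ} (hδ : 0 < δ) :
    ∃ T, ∀ t ≥ T, ∀ s ≥ 0, |h (t + s) - h t| ≤ 2 + δ * s := by
  obtain ⟨T₁, hT₁⟩ := exists_forall_abs_increment_le_two hm hlim
  have hstep : ∀ᶠ t in atTop, |h (t + 1) - h t| < δ := by
    simpa using (hlim 1).abs.eventually (gt_mem_nhds (by simpa using hδ))
  obtain ⟨T₂, hT₂⟩ := eventually_atTop.1 hstep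
  have hnat (n : ℕ) : ∀ t ≥ T₂, |h (t + n) - h t| ≤ δ * n := by
    intro t ht
    induction n with
    | zero => simp
    | succ n ih =>
      have h1 := (hT₂ (t + n) (by linarith [n.cast_nonneg (α := ℝ)])).le
      push_cast
      rw [← add_assoc]
      rw [abs_le] at *
      constructor <;> linarith [h1.1, h1.2, ih.1, ih.2]
  refine ⟨max T₁ T₂, fun t ht s hs => ?_⟩
  have hfl := Nat.floor_le hs
  have hn := hnat ⌊s⌋₊ t (le_of_max_le_right ht)
  have hr := hT₁ (t + ⌊s⌋₊)
    (by linarith [le_of_max_le_left ht, (⌊s⌋₊).cast_nonneg (α := ℝ)]) (s - ⌊s⌋₊)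
    ⟨by linarith, by linarith [Nat.lt_floor_add_one s]⟩
  rw [show t + ⌊s⌋₊ + (s - ⌊s⌋₊) = t + s by ring] at hr
  have := mul_le_mul_of_nonneg_left hfl hδ.le
  rw [abs_le] at *
  constructor <;> linarith [hn.1, hn.2, hr.1, hr.2]

/-- Potter's bound for slowly varying functions. -/
lemma exists_slowlyVarying_le {K : ℝ → ℝ} (hm : Measurable K) (hpos : ∀ x, 0 < x → 0 < K x)
    (hslow : ∀ c : ℝ, 0 < c → Tendsto (fun l : ℝ => K (c * l) / K l) atTop (𝓝 1))
    {δ : ℝ} (hδ : 0 < δ) :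
    ∃ X > 0, ∀ l ≥ X, ∀ y ≥ X, K y ≤ Real.exp 2 * Real.exp (δ * |Real.log (y / l)|) * K l := by
  let h : ℝ → ℝ := fun t => Real.log (K (Real.exp t))
  have hlim (u : ℝ) : Tendsto (fun t => h (t + u) - h t) atTop (𝓝 0) := by
    have := (((hslow _ (Real.exp_pos u)).comp Real.tendsto_exp_atTop).log one_ne_zero)
    rw [Real.log_one] at this
    refine this.congr fun t => ?_
    simp only [Function.comp, h]
    rw [Real.log_div (hpos _ (by positivity)).ne' (hpos _ (by positivity)).ne', ← Real.exp_add,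
      add_comm u t]
  obtain ⟨T, hT⟩ := exists_forall_abs_increment_le
    (h := h) (Real.measurable_log.comp (hm.comp Real.measurable_exp)) hlim hδ
  refine ⟨Real.exp T, Real.exp_pos T, fun l hl y hy => ?_⟩
  have hl0 := (Real.exp_pos T).trans_le hl
  have hy0 := (Real.exp_pos T).trans_le hy
  have hlT := (Real.le_log_iff_exp_le hl0).2 hl
  have hyT := (Real.le_log_iff_exp_le hy0).2 hy
  have hdiff : Real.log (K y) - Real.log (K l) ≤ 2 + δ * |Real.log y - Real.log l| := by
    rcases le_total (Real.log l) (Real.log y) with hle | hle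
    · have := (abs_le.1 (hT _ hlT (Real.log y - Real.log l) (by linarith))).2
      simpa [h, Real.exp_log hl0, Real.exp_log hy0, abs_of_nonneg (sub_nonneg.2 hle)] using this
    · have := (abs_le.1 (hT _ hyT (Real.log l - Real.log y) (by linarith))).1
      simp only [h, add_sub_cancel, Real.exp_log hl0, Real.exp_log hy0] at this
      rw [abs_of_nonpos (sub_nonpos.2 hle)]
      linarith
  rw [Real.log_div hy0.ne' hl0.ne', ← Real.exp_log (hpos l hl0), ← Real.exp_add, ← Real.exp_add,
    ← Real.log_le_iff_le_exp (hpos y hy0)]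
  linarith

lemma rpow_mul_exp_abs_log_le_max {γ γ' γ'' δ x : ℝ} (h1 : γ' ≤ γ - δ) (h2 : γ + δ ≤ γ'')
    (hx : 0 < x) :
    x ^ γ * Real.exp (δ * |Real.log x|) ≤ max (x ^ γ') (x ^ γ'') := by
  simp only [Real.rpow_def_of_pos hx, ← Real.exp_add]
  rcases le_total 0 (Real.log x) with h | h
  · refine le_max_of_le_right (Real.exp_le_exp.2 ?_)
    rw [abs_of_nonneg h]
    nlinarith
  · refine le_max_of_le_left (Real.exp_le_exp.2 ?_)
    rw [abs_of_nonpos h]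
    nlinarith

lemma exists_le_mul_rpow_of_le {f : ℝ → ℝ} {γ : ℝ}
    (hf_nonneg : ∀ x, 0 < x → 0 ≤ f x)
    (hf_locbdd : ∀ a b : ℝ, 0 < a → ∃ M : ℝ, ∀ x ∈ Set.Icc a b, f x ≤ M)
    (hf_zero : ∃ C ε : ℝ, 0 < ε ∧ ∀ x : ℝ, 0 < x → x < ε → f x * x ^ (-γ) ≤ C) (X : ℝ) :
    ∃ B ≥ 0, ∀ y, 0 < y → y ≤ X → f y ≤ B * y ^ γ := by
  obtain ⟨C, ε, hε, hC⟩ := hf_zero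
  obtain ⟨M, hM⟩ := hf_locbdd ε X hε
  obtain ⟨N, hN⟩ := isCompact_Icc.exists_bound_of_continuousOn
    (s := Icc ε X) (f := fun y : ℝ => y ^ (-γ))
    fun y hy => (Real.continuousAt_rpow_const _ _ (.inl (hε.trans_le hy.1).ne')).continuousWithinAt
  refine ⟨max 0 (max C (M * N)), le_max_left _ _, fun y hy hyX => ?_⟩
  have hle : f y * y ^ (-γ) ≤ max 0 (max C (M * N)) := by
    rcases lt_or_ge y ε with h | h
    · exact (hC y hy h).trans ((le_max_left _ _).trans (le_max_right _ _))
    · refine le_trans ?_ ((le_max_right _ _).trans (le_max_right _ _))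
      exact mul_le_mul (hM y ⟨h, hyX⟩) ((le_abs_self _).trans (hN y ⟨h, hyX⟩)) (by positivity)
        ((hf_nonneg y hy).trans (hM y ⟨h, hyX⟩))
  rwa [Real.rpow_neg hy.le, ← div_eq_mul_inv, div_le_iff₀ (by positivity)] at hle

/-- Lemma 6.6: potter-type bound for a function regularly varying at infinity
with index `γ`, locally bounded, nonnegative, and with
`limsup_{x→0+} f(x) x^{-γ} < ∞`. -/
theorem stmt_0
    (f K : ℝ → ℝ) (γ : ℝ)
    (hf_meas : Measurable f)
    (hf_nonneg : ∀ x, 0 < x → 0 ≤ f x)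
    (hf_locbdd : ∀ a b : ℝ, 0 < a → ∃ M : ℝ, ∀ x ∈ Set.Icc a b, f x ≤ M)
    (hK_meas : Measurable K)
    (hK_pos : ∀ x, 0 < x → 0 < K x)
    (hK_slow : ∀ c : ℝ, 0 < c → Tendsto (fun l : ℝ => K (c * l) / K l) atTop (𝓝 1))
    (hf_asymp : Tendsto (fun x : ℝ => f x / (x ^ γ * K x)) atTop (𝓝 1))
    (hf_zero : ∃ C ε : ℝ, 0 < ε ∧ ∀ x : ℝ, 0 < x → x < ε → f x * x ^ (-γ) ≤ C)
    (γ' γ'' : ℝ) (h1 : γ' < γ) (h2 : γ < γ'') :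
    ∃ C > (0:ℝ), ∃ lam0 > (0:ℝ), ∀ x > (0:ℝ), ∀ l > lam0,
      f (l * x) / (l ^ γ * K l) ≤ C * max (x ^ γ') (x ^ γ'') := by
  obtain ⟨δ, hδ, hδ1, hδ2⟩ : ∃ δ > 0, γ' ≤ γ - δ ∧ γ + δ ≤ γ'' :=
    ⟨min (γ - γ') (γ'' - γ), lt_min (by linarith) (by linarith),
      by linarith [min_le_left (γ - γ') (γ'' - γ)],
      by linarith [min_le_right (γ - γ') (γ'' - γ)]⟩
  obtain ⟨X₁, hX₁, hpotter⟩ := exists_slowlyVarying_le hK_meas hK_pos hK_slow hδ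
  obtain ⟨X₂, hX₂⟩ := eventually_atTop.1 (hf_asymp.eventually (gt_mem_nhds one_lt_two))
  obtain ⟨X, hXX₁, hXX₂⟩ : ∃ X, X₁ ≤ X ∧ X₂ ≤ X := ⟨_, le_max_left _ _, le_max_right _ _⟩
  have hX := hX₁.trans_le hXX₁
  have hKX := hK_pos X hX
  obtain ⟨B, hB, hfB⟩ := exists_le_mul_rpow_of_le hf_nonneg hf_locbdd hf_zero X
  refine ⟨Real.exp 2 * (2 + B / K X), by positivity, X, hX, fun x hx l hl => ?_⟩
  have hl0 := hX.trans hl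
  have hKl := hK_pos l hl0
  suffices hmain : f (l * x) ≤ Real.exp 2 * (2 + B / K X) *
      (x ^ γ * Real.exp (δ * |Real.log x|)) * (l ^ γ * K l) by
    rw [div_le_iff₀ (by positivity)]
    refine hmain.trans ?_
    gcongr
    exact rpow_mul_exp_abs_log_le_max hδ1 hδ2 hx
  have hlx : 0 < l * x := by positivity
  set E := Real.exp (δ * |Real.log x|)
  have hE : 0 < E := Real.exp_pos _
  rcases le_or_gt X (l * x) with h | h
  · have hf := (hX₂ (l * x) (hXX₂.trans h)).le
    have hKlx := hK_pos _ hlx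
    rw [div_le_iff₀ (by positivity)] at hf
    have hp := hpotter l (hXX₁.trans hl.le) (l * x) (hXX₁.trans h)
    rw [mul_div_cancel_left₀ x hl0.ne'] at hp
    calc f (l * x) ≤ 2 * ((l * x) ^ γ * K (l * x)) := hf
      _ ≤ 2 * ((l * x) ^ γ * (Real.exp 2 * E * K l)) := by gcongr
      _ = Real.exp 2 * 2 * (x ^ γ * E) * (l ^ γ * K l) := by
        rw [Real.mul_rpow hl0.le hx.le]; ring
      _ ≤ _ := by gcongr; exact le_add_of_nonneg_right (by positivity)
  · have hp := hpotter l (hXX₁.trans hl.le) X hXX₁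
    have hEle : Real.exp (δ * |Real.log (X / l)|) ≤ E := by
      have hxX : Real.log x ≤ Real.log (X / l) :=
        Real.log_le_log hx ((le_div_iff₀ hl0).2 (by linarith))
      have hXl : Real.log (X / l) ≤ 0 :=
        Real.log_nonpos (by positivity) ((div_le_one hl0).2 hl.le)
      simp only [E]
      rw [abs_of_nonpos hXl, abs_of_nonpos (hxX.trans hXl)]
      gcongr
    calc f (l * x) ≤ B * (l * x) ^ γ := hfB _ hlx h.le
      _ = B / K X * (l * x) ^ γ * K X := by field_simp
      _ ≤ B / K X * (l * x) ^ γ * (Real.exp 2 * E * K l) := by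
        gcongr
        exact hp.trans (by gcongr)
      _ = Real.exp 2 * (B / K X) * (x ^ γ * E) * (l ^ γ * K l) := by
        rw [Real.mul_rpow hl0.le hx.le]; ring
      _ ≤ _ := by gcongr; linarith
end

section
/- Let 0 < β < 1, let L be slowly varying at infinity, and let J : (0,∞) → [0,∞] be right-continuous and nondecreasing with J(z) → ∞ as z → ∞. Define the right-continuous inverse J^{-1}(x) = inf{z > 0 : J(z) > x} for x > 0, and assume J^{-1}(x) ~ (β/(1−β)) x^{1−β} L(x) as x → ∞. Then for every z > 0, (1/λ) · J(λ^{1−β} L(λ) z) → ((1−β)z/β)^{1/(1−β)} as λ → ∞. (Convergence (4.8); Lemma 5.5, divergent case) -/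
open Filter Topology Set ENNReal

/-- The limit of `Jinv (c * l)` along the scale `l ^ p * L l`, for `Jinv` regularly varying of
index `p`. -/
lemma tendsto_comp_mul_div_rpow_mul {p K c : ℝ} (hK : 0 < K) (hc : 0 < c) {L Jinv : ℝ → ℝ}
    (hL_pos : ∀ x, 0 < x → 0 < L x)
    (hL_slow : Tendsto (fun l : ℝ => L (c * l) / L l) atTop (𝓝 1))
    (h : Tendsto (fun x : ℝ => Jinv x / (K * x ^ p * L x)) atTop (𝓝 1)) :
    Tendsto (fun l : ℝ => Jinv (c * l) / (l ^ p * L l)) atTop (𝓝 (K * c ^ p)) := by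
  have hcl : Tendsto (fun l : ℝ => c * l) atTop atTop := tendsto_id.const_mul_atTop hc
  have h2 := ((h.comp hcl).mul hL_slow).mul_const (K * c ^ p)
  rw [one_mul, one_mul] at h2
  refine h2.congr' ?_
  filter_upwards [eventually_gt_atTop 0] with l hl
  have h3 := (hL_pos l hl).ne'
  have h4 := (hL_pos (c * l) (mul_pos hc hl)).ne'
  have h5 := (Real.rpow_pos_of_pos hl p).ne'
  have h6 := (Real.rpow_pos_of_pos hc p).ne'
  simp only [Function.comp_apply]
  rw [Real.mul_rpow hc.le hl.le]
  field_simp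

/-- Convergence (4.8) (Lemma 5.5, divergent case): if `J : (0,∞) → [0,∞]` is
right-continuous, nondecreasing, tends to `∞`, and its right-continuous inverse
satisfies `J⁻¹(x) ~ (β/(1-β)) x^{1-β} L(x)` as `x → ∞` with `0 < β < 1` and `L`
slowly varying, then `(1/λ) J(λ^{1-β} L(λ) z) → ((1-β)z/β)^{1/(1-β)}` for every
`z > 0`. -/
theorem stmt_4 (β : ℝ) (hβ0 : 0 < β) (hβ1 : β < 1)
    (L : ℝ → ℝ)
    (hL_meas : Measurable L) (hL_pos : ∀ x, 0 < x → 0 < L x)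
    (hL_slow : ∀ c : ℝ, 0 < c → Tendsto (fun l : ℝ => L (c * l) / L l) atTop (𝓝 1))
    (J : ℝ → ℝ≥0∞)
    (hJ_mono : MonotoneOn J (Set.Ioi 0))
    (hJ_rc : ∀ z > (0:ℝ), ContinuousWithinAt J (Set.Ioi z) z)
    (hJ_top : Tendsto J atTop (𝓝 ⊤))
    (Jinv : ℝ → ℝ)
    (hJinv : ∀ x : ℝ, 0 < x →
      Jinv x = sInf {z : ℝ | 0 < z ∧ ENNReal.ofReal x < J z})
    (hJinv_asymp : Tendsto (fun x : ℝ => Jinv x / ((β / (1 - β)) * x ^ (1 - β) * L x))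
      atTop (𝓝 1)) :
    ∀ z > (0:ℝ), Tendsto (fun l : ℝ => J (l ^ (1 - β) * L l * z) / ENNReal.ofReal l)
      atTop (𝓝 (ENNReal.ofReal (((1 - β) * z / β) ^ (1 / (1 - β))))) := by
  intro z hz
  have hp : 0 < 1 - β := sub_pos.2 hβ1
  have hK : 0 < β / (1 - β) := div_pos hβ0 hp
  have hw : 0 < (1 - β) * z / β := by positivity
  have hA : 0 < ((1 - β) * z / β) ^ (1 / (1 - β)) := Real.rpow_pos_of_pos hw _
  have hAp : β / (1 - β) * (((1 - β) * z / β) ^ (1 / (1 - β))) ^ (1 - β) = z := by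
    rw [← Real.rpow_mul hw.le, one_div_mul_cancel hp.ne', Real.rpow_one]
    field_simp
  set A := ((1 - β) * z / β) ^ (1 / (1 - β))
  have hlim : ∀ c : ℝ, 0 < c → Tendsto (fun l : ℝ => Jinv (c * l) / (l ^ (1 - β) * L l)) atTop
      (𝓝 (β / (1 - β) * c ^ (1 - β))) := fun c hc =>
    tendsto_comp_mul_div_rpow_mul hK hc hL_pos (hL_slow c hc) hJinv_asymp
  have hscale : ∀ l : ℝ, 0 < l → 0 < l ^ (1 - β) * L l := fun l hl =>
    mul_pos (Real.rpow_pos_of_pos hl _) (hL_pos l hl)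
  refine tendsto_order.2 ⟨fun a ha => ?_, fun b hb => ?_⟩
  · obtain ⟨c, -, hac, hcA⟩ := ENNReal.lt_iff_exists_real_btwn.1 ha
    have hc : 0 < c := ENNReal.ofReal_pos.1 (bot_le.trans_lt hac)
    have hcA' : c < A := lt_of_not_ge fun h => hcA.not_ge (ENNReal.ofReal_le_ofReal h)
    have hcz : β / (1 - β) * c ^ (1 - β) < z := by
      rw [← hAp]
      exact mul_lt_mul_of_pos_left (Real.rpow_lt_rpow hc.le hcA' hp) hK
    filter_upwards [(hlim c hc).eventually_lt_const hcz, eventually_gt_atTop 0] with l hl hl0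
    rw [div_lt_iff₀ (hscale l hl0), hJinv _ (mul_pos hc hl0), mul_comm z] at hl
    have hne : {z : ℝ | 0 < z ∧ ENNReal.ofReal (c * l) < J z}.Nonempty :=
      ((eventually_gt_atTop 0).and (hJ_top.eventually_const_lt ENNReal.ofReal_lt_top)).exists
    obtain ⟨y, ⟨hy0, hy⟩, hyu⟩ := exists_lt_of_csInf_lt hne hl
    have hJu := hy.le.trans (hJ_mono hy0 (hy0.trans hyu) hyu.le)
    refine hac.trans_le ?_
    rw [ENNReal.le_div_iff_mul_le (by simp [hl0]) (by simp), ← ENNReal.ofReal_mul hc.le]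
    exact hJu
  · obtain ⟨c, -, hAc, hcb⟩ := ENNReal.lt_iff_exists_real_btwn.1 hb
    have hAc' : A < c := lt_of_not_ge fun h => hAc.not_ge (ENNReal.ofReal_le_ofReal h)
    have hc : 0 < c := hA.trans hAc'
    have hcz : z < β / (1 - β) * c ^ (1 - β) := by
      conv_lhs => rw [← hAp]
      exact mul_lt_mul_of_pos_left (Real.rpow_lt_rpow hA.le hAc' hp) hK
    filter_upwards [(hlim c hc).eventually_const_lt hcz, eventually_gt_atTop 0] with l hl hl0
    rw [lt_div_iff₀ (hscale l hl0), hJinv _ (mul_pos hc hl0), mul_comm z] at hl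
    have hJu : J (l ^ (1 - β) * L l * z) ≤ ENNReal.ofReal (c * l) := le_of_not_gt fun h =>
      notMem_of_lt_csInf hl ⟨0, fun _ hy => hy.1.le⟩ ⟨mul_pos (hscale l hl0) hz, h⟩
    refine lt_of_le_of_lt (ENNReal.div_le_of_le_mul ?_) hcb
    rwa [← ENNReal.ofReal_mul hc.le]
end
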